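/- arXiv:2603.02449 — 5 statements merged into one kernel-verified Lean document; each statement's English description precedes it below -/
import Mathlib

section
/- Let V be a real vector space and B a symmetric bilinear form on V. Index the vertices of the combinatorial 3-cube by subsets I ⊆ {1,2,3}; for each pair {i,j} ⊂ {1,2,3} with complementary index k, the bottom face f^{ij} has corners ∅, {i}, {j}, {i,j}, and the top face f^{ij}_k has corners {k}, {i,k}, {j,k}, {1,2,3}. Suppose given vectors g_I ∈ V for all eight vertices I, vectors p(f) ∈ V for all six faces f, and subspaces Π_I ≤ V for the seven vertices I ≠ {1,2,3}, such that: (a) for each vertex I ≠ {1,2,3} and each face f of the cube having I as a corner, p(f) ∈ Π_I; (b) B(g_I, y) = 0 for all y ∈ Π_I and all I ≠ {1,2,3}; (c) for each top face f^{ij}_k, the vector g_{123} lies in the linear span of the vectors g_{{k}}, g_{{i,k}}, g_{{j,k}} at its other three corners. Then B(g_I, p(f)) = 0 for every vertex I and every face f of the cube with I a corner of f; in particular the polarity relations hold at the three top faces and at the vertex {1,2,3}. This is the elementary-cube propagation step showing that polar conjugate binets are a consistent reduction of conjugate binets. -/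
/-- Vertices of the combinatorial 3-cube are subsets `I ⊆ {1,2,3}`, and its six faces are
indexed by pairs `(k, b)` with `k : Fin 3` and `b : Bool`: the face `(k, b)` has as its
corners exactly the vertices `I` with `(k ∈ I) = b`.  For the complementary pair `{i,j}`,
`(k, false)` is the bottom face `f^{ij}` (corners `∅, {i}, {j}, {i,j}`) and `(k, true)` is
the top face `f^{ij}_k` (corners `{k}, {i,k}, {j,k}, {1,2,3}`). -/
def IsCubeCorner (I : Finset (Fin 3)) (k : Fin 3) (b : Bool) : Prop :=
  (k ∈ I ↔ b = true)

/-- The elementary-cube propagation step for polar conjugate binets: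
if the polarity relations `B(g_I, p(f)) = 0` hold at the seven vertices `I ≠ {1,2,3}`
(via the planes `Π_I` containing the face points of the incident faces), and `g_{123}`
lies in the span of the other three corner vectors of each top face, then polarity holds
at every vertex-face incidence of the cube, in particular at the three top faces and at
the vertex `{1,2,3}`. -/
theorem polar_binet_cube_propagation {V : Type*} [AddCommGroup V] [Module ℝ V]
    (B : V →ₗ[ℝ] V →ₗ[ℝ] ℝ) (hBsymm : ∀ u w : V, B u w = B w u)
    (g : Finset (Fin 3) → V) (p : Fin 3 → Bool → V)
    (Pl : Finset (Fin 3) → Submodule ℝ V)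
    -- (a) for each vertex `I ≠ {1,2,3}` and each face of the cube having `I` as a corner,
    -- the face point lies in the plane `Π_I`
    (ha : ∀ I : Finset (Fin 3), I ≠ Finset.univ → ∀ (k : Fin 3) (b : Bool),
      IsCubeCorner I k b → p k b ∈ Pl I)
    -- (b) `g_I` is polar to its plane `Π_I` for all `I ≠ {1,2,3}`
    (hb : ∀ I : Finset (Fin 3), I ≠ Finset.univ → ∀ y ∈ Pl I, B (g I) y = 0)
    -- (c) for each top face, `g_{123}` lies in the span of the vectors at its
    -- other three corners
    (hc : ∀ k : Fin 3, g Finset.univ ∈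
      Submodule.span ℝ (g '' {I : Finset (Fin 3) | k ∈ I ∧ I ≠ Finset.univ})) :
    ∀ (I : Finset (Fin 3)) (k : Fin 3) (b : Bool), IsCubeCorner I k b →
      B (g I) (p k b) = 0 := by
  intro I k b hI
  by_cases hne : I = Finset.univ
  · subst hne
    have hk : b = true := hI.mp (Finset.mem_univ k)
    subst hk
    have hle : Submodule.span ℝ (g '' {I : Finset (Fin 3) | k ∈ I ∧ I ≠ Finset.univ}) ≤
        LinearMap.ker (B.flip (p k true)) := by
      rw [Submodule.span_le]
      rintro _ ⟨J, ⟨hkJ, hJ⟩, rfl⟩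
      exact hb J hJ _ (ha J hJ k true (iff_of_true hkJ rfl))
    exact hle (hc k)
  · exact hb I hne _ (ha I hne k b hI)
end

section
/- Let n ≥ 1 and let c₁, c₂, d₁, d₂ ∈ ℝ^n satisfy ⟨c₁ − c₂, d₁ − d₂⟩ = 0. Then for every ρ₁ ∈ ℝ there exist unique ρ₂, σ₁, σ₂ ∈ ℝ such that ‖c_a − d_b‖² = ρ_a + σ_b for all a, b ∈ {1,2}; consequently the set of solutions (ρ₁, ρ₂, σ₁, σ₂) ∈ ℝ⁴ of these four equations is a one-parameter family. -/
open RealInnerProductSpace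

/-- The two sums of squared lengths of opposite sides of a quadrilateral agree when its diagonals
are orthogonal. -/
theorem norm_sub_sq_add_norm_sub_sq_of_inner_eq_zero {E : Type*} [NormedAddCommGroup E]
    [InnerProductSpace ℝ E] {c₁ c₂ d₁ d₂ : E} (h : inner ℝ (c₁ - c₂) (d₁ - d₂) = 0) :
    ‖c₁ - d₁‖ ^ 2 + ‖c₂ - d₂‖ ^ 2 = ‖c₁ - d₂‖ ^ 2 + ‖c₂ - d₁‖ ^ 2 := by
  simp only [inner_sub_left, inner_sub_right] at h
  simp only [norm_sub_sq_real]
  linarith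

/-- The system `A = ρ₁ + σ₁`, `B = ρ₁ + σ₂`, `C = ρ₂ + σ₁`, `D = ρ₂ + σ₂` with `A + D = B + C` has
its solutions parametrized by `ρ₁`. -/
def crossSolutionEquiv {A B C D : ℝ} (h : A + D = B + C) :
    ℝ ≃ {q : ℝ × ℝ × ℝ × ℝ //
      A = q.1 + q.2.2.1 ∧ B = q.1 + q.2.2.2 ∧ C = q.2.1 + q.2.2.1 ∧ D = q.2.1 + q.2.2.2} where
  toFun r := ⟨(r, C - A + r, A - r, B - r), by
    refine ⟨?_, ?_, ?_, ?_⟩ <;> dsimp only <;> linarith⟩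
  invFun q := q.1.1
  left_inv _ := rfl
  right_inv := by
    rintro ⟨⟨ρ₁, ρ₂, σ₁, σ₂⟩, h₁, h₂, h₃, h₄⟩
    simp only [Subtype.mk.injEq, Prod.mk.injEq] at *
    refine ⟨trivial, ?_, ?_, ?_⟩ <;> linarith

/-- If the two diagonal lines of a cross are orthogonal,
`⟨c₁ − c₂, d₁ − d₂⟩ = 0`, then for every `ρ₁` there exist unique `ρ₂, σ₁, σ₂` with
`‖c_a − d_b‖² = ρ_a + σ_b` for all `a, b ∈ {1,2}`; consequently the set of solutions
`(ρ₁, ρ₂, σ₁, σ₂) ∈ ℝ⁴` is a one-parameter family (parametrized bijectively by `ρ₁`). -/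
theorem sphere_representation_of_orthogonal_cross {n : ℕ} (hn : 1 ≤ n)
    (c₁ c₂ d₁ d₂ : EuclideanSpace ℝ (Fin n))
    (h : ⟪c₁ - c₂, d₁ - d₂⟫ = 0) :
    (∀ ρ₁ : ℝ, ∃! t : ℝ × ℝ × ℝ,
      ‖c₁ - d₁‖ ^ 2 = ρ₁ + t.2.1 ∧ ‖c₁ - d₂‖ ^ 2 = ρ₁ + t.2.2 ∧
      ‖c₂ - d₁‖ ^ 2 = t.1 + t.2.1 ∧ ‖c₂ - d₂‖ ^ 2 = t.1 + t.2.2) ∧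
    ∃ φ : ℝ ≃ {q : ℝ × ℝ × ℝ × ℝ //
        ‖c₁ - d₁‖ ^ 2 = q.1 + q.2.2.1 ∧ ‖c₁ - d₂‖ ^ 2 = q.1 + q.2.2.2 ∧
        ‖c₂ - d₁‖ ^ 2 = q.2.1 + q.2.2.1 ∧ ‖c₂ - d₂‖ ^ 2 = q.2.1 + q.2.2.2},
      ∀ r : ℝ, ((φ r : ℝ × ℝ × ℝ × ℝ)).1 = r := by
  have key := norm_sub_sq_add_norm_sub_sq_of_inner_eq_zero h
  refine ⟨fun ρ₁ ↦ ⟨(‖c₂ - d₁‖ ^ 2 - ‖c₁ - d₁‖ ^ 2 + ρ₁, ‖c₁ - d₁‖ ^ 2 - ρ₁,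
    ‖c₁ - d₂‖ ^ 2 - ρ₁), ?_, ?_⟩, crossSolutionEquiv key, fun _ ↦ rfl⟩
  · refine ⟨?_, ?_, ?_, ?_⟩ <;> dsimp only <;> linarith
  · rintro ⟨ρ₂, σ₁, σ₂⟩ ⟨h₁, h₂, h₃, h₄⟩
    simp only [Prod.mk.injEq] at *
    refine ⟨?_, ?_, ?_⟩ <;> linarith
end

section
/- Let U ⊆ ℝ³ be a nonempty open set. Let x : ℝ³ → ℝ³ be C² on U, and for all distinct i, j ∈ {1,2,3} let a_{ij} : ℝ³ → ℝ be C¹ on U, such that on U: ∂_i∂_j x = a_{ij} ∂_i x + a_{ji} ∂_j x for all distinct i, j, and ∂_k a_{ij} = a_{ij} a_{jk} + a_{kj} a_{ik} − a_{ij} a_{ik} for all distinct i, j, k (triply conjugate system with compatibility conditions). Assume each a_{ij} is nonvanishing on U and a_{21}(p) ≠ a_{31}(p) for every p ∈ U. Define L_{13} := x − (1/a_{31}) ∂_1 x on U. Then the following are equivalent: (i) ⟨∂_1 x, ∂_2 x⟩ = 0 and ⟨∂_2 L_{13}, ∂_3 x⟩ = 0 everywhere on U; (ii) ⟨∂_i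 x, ∂_j x⟩ = 0 everywhere on U for all distinct i, j ∈ {1,2,3} (the triply conjugate system is orthogonal). -/
open RealInnerProductSpace

/-- `∂_i` of a vector-valued map: the derivative in the direction of the `i`-th standard
basis vector of `ℝ³`. -/
noncomputable def pd (x : EuclideanSpace ℝ (Fin 3) → EuclideanSpace ℝ (Fin 3))
    (i : Fin 3) (p : EuclideanSpace ℝ (Fin 3)) : EuclideanSpace ℝ (Fin 3) :=
  fderiv ℝ x p (EuclideanSpace.single i 1)

/-- `∂_i` of a scalar function. -/
noncomputable def pds (a : EuclideanSpace ℝ (Fin 3) → ℝ) (i : Fin 3)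
    (p : EuclideanSpace ℝ (Fin 3)) : ℝ :=
  fderiv ℝ a p (EuclideanSpace.single i 1)

/-- The partial derivatives of a map that is `C²` at `p` are differentiable at `p`. -/
theorem ContDiffAt.differentiableAt_pd
    {x : EuclideanSpace ℝ (Fin 3) → EuclideanSpace ℝ (Fin 3)} {p : EuclideanSpace ℝ (Fin 3)}
    (hx : ContDiffAt ℝ 2 x p) (i : Fin 3) : DifferentiableAt ℝ (pd x i) p := by
  have h : ContDiffAt ℝ 1 (fderiv ℝ x) p := hx.fderiv_right (by norm_num)
  exact (h.differentiableAt one_ne_zero).clm_apply (differentiableAt_const _)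

/-- The derivative of a Laplace transform `x - b⁻¹ ∂ᵢx` in the direction of `∂ⱼ`. -/
theorem pd_sub_inv_smul_pd
    {x : EuclideanSpace ℝ (Fin 3) → EuclideanSpace ℝ (Fin 3)}
    {b : EuclideanSpace ℝ (Fin 3) → ℝ} {p : EuclideanSpace ℝ (Fin 3)} (i j : Fin 3)
    (hx : ContDiffAt ℝ 2 x p) (hb : DifferentiableAt ℝ b p) (hb0 : b p ≠ 0) :
    pd (fun q => x q - (b q)⁻¹ • pd x i q) j p =
      pd x j p - ((b p)⁻¹ • pd (pd x i) j p - (pds b j p / b p ^ 2) • pd x i p) := by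
  have h := (hx.differentiableAt two_ne_zero).hasFDerivAt.sub
    (((hasDerivAt_inv hb0).comp_hasFDerivAt p hb.hasFDerivAt).smul
      (hx.differentiableAt_pd i).hasFDerivAt)
  have h' := congrArg (fun L => L (EuclideanSpace.single j 1)) h.fderiv
  refine h'.trans ?_
  simp [pd, pds, div_eq_inv_mul, sub_eq_add_neg]

/-- The product rule for `∂ₖ⟨∂ᵢx, ∂ⱼx⟩` where `⟨∂ᵢx, ∂ⱼx⟩` vanishes on an open set. -/
theorem inner_pd_pd_add_inner_pd_pd_eq_zero
    {U : Set (EuclideanSpace ℝ (Fin 3))} (hU : IsOpen U)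
    {x : EuclideanSpace ℝ (Fin 3) → EuclideanSpace ℝ (Fin 3)} (hx : ContDiffOn ℝ 2 x U)
    {i j : Fin 3} (h : ∀ p ∈ U, ⟪pd x i p, pd x j p⟫ = 0) (k : Fin 3)
    {p : EuclideanSpace ℝ (Fin 3)} (hp : p ∈ U) :
    ⟪pd x i p, pd (pd x j) k p⟫ + ⟪pd (pd x i) k p, pd x j p⟫ = 0 := by
  have hxp := hx.contDiffAt (hU.mem_nhds hp)
  have hev : (fun q => ⟪pd x i q, pd x j q⟫) =ᶠ[nhds p] fun _ => (0 : ℝ) :=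
    Filter.eventually_of_mem (hU.mem_nhds hp) h
  have hd := fderiv_inner_apply (𝕜 := ℝ) (hxp.differentiableAt_pd i) (hxp.differentiableAt_pd j)
    (EuclideanSpace.single k 1)
  rw [hev.fderiv_eq] at hd
  simpa [pd] using hd.symm

/-- A triply conjugate system (with nonvanishing coefficients and
nondegenerate Laplace transform `L₁₃ = x − (1/a₃₁)∂₁x`, i.e. `a₂₁ ≠ a₃₁`) is orthogonal
if and only if `⟨∂₁x, ∂₂x⟩ = 0` and `⟨∂₂L₁₃, ∂₃x⟩ = 0` on `U`.
(Indices `1, 2, 3` correspond to `0, 1, 2 : Fin 3`.) -/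
theorem orthogonal_system_from_focal_points
    (U : Set (EuclideanSpace ℝ (Fin 3))) (hU : IsOpen U) (hUne : U.Nonempty)
    (x : EuclideanSpace ℝ (Fin 3) → EuclideanSpace ℝ (Fin 3))
    (hx : ContDiffOn ℝ 2 x U)
    (a : Fin 3 → Fin 3 → EuclideanSpace ℝ (Fin 3) → ℝ)
    (ha : ∀ i j : Fin 3, i ≠ j → ContDiffOn ℝ 1 (a i j) U)
    -- the equations ∂ᵢ∂ⱼx = aᵢⱼ ∂ᵢx + aⱼᵢ ∂ⱼx of a triply conjugate system
    (heq : ∀ i j : Fin 3, i ≠ j → ∀ p ∈ U,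
      pd (pd x j) i p = a i j p • pd x i p + a j i p • pd x j p)
    -- the compatibility conditions ∂ₖaᵢⱼ = aᵢⱼaⱼₖ + aₖⱼaᵢₖ − aᵢⱼaᵢₖ
    (hcompat : ∀ i j k : Fin 3, i ≠ j → i ≠ k → j ≠ k → ∀ p ∈ U,
      pds (a i j) k p = a i j p * a j k p + a k j p * a i k p - a i j p * a i k p)
    -- nonvanishing coefficients
    (hnz : ∀ i j : Fin 3, i ≠ j → ∀ p ∈ U, a i j p ≠ 0)
    -- nondegeneracy: a₂₁ ≠ a₃₁ on U
    (hne : ∀ p ∈ U, a 1 0 p ≠ a 2 0 p) :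
    -- (i) ⟨∂₁x, ∂₂x⟩ = 0 and ⟨∂₂L₁₃, ∂₃x⟩ = 0 on U, where L₁₃ = x − (1/a₃₁)∂₁x
    ((∀ p ∈ U, ⟪pd x 0 p, pd x 1 p⟫ = 0 ∧
        ⟪pd (fun q => x q - (a 2 0 q)⁻¹ • pd x 0 q) 1 p, pd x 2 p⟫ = 0) ↔
    -- (ii) the triply conjugate system is orthogonal
      (∀ p ∈ U, ∀ i j : Fin 3, i ≠ j → ⟪pd x i p, pd x j p⟫ = 0)) := by
  have hinner : ∀ p ∈ U, ⟪pd (fun q => x q - (a 2 0 q)⁻¹ • pd x 0 q) 1 p, pd x 2 p⟫ =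
      (a 2 0 p - a 1 0 p) / a 2 0 p ^ 2 *
        (a 2 0 p * ⟪pd x 1 p, pd x 2 p⟫ - a 2 1 p * ⟪pd x 0 p, pd x 2 p⟫) := by
    intro p hp
    have h20 := hnz 2 0 (by decide) p hp
    have hb := ((ha 2 0 (by decide)).contDiffAt (hU.mem_nhds hp)).differentiableAt one_ne_zero
    rw [pd_sub_inv_smul_pd 0 1 (hx.contDiffAt (hU.mem_nhds hp)) hb h20,
      heq 1 0 (by decide) p hp, hcompat 2 0 1 (by decide) (by decide) (by decide) p hp]
    simp only [inner_sub_left, inner_add_left, real_inner_smul_left]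
    field_simp
    ring
  constructor
  · intro h p hp
    have h01 := (h p hp).1
    have h20 := hnz 2 0 (by decide) p hp
    have h21 := hnz 2 1 (by decide) p hp
    have hfocal := (h p hp).2
    rw [hinner p hp, mul_eq_zero, or_iff_right
      (div_ne_zero (sub_ne_zero.2 (hne p hp).symm) (pow_ne_zero 2 h20))] at hfocal
    have hdiff := inner_pd_pd_add_inner_pd_pd_eq_zero hU hx (fun q hq => (h q hq).1) 2 hp
    rw [heq 2 0 (by decide) p hp, heq 2 1 (by decide) p hp] at hdiff
    simp only [inner_add_left, inner_add_right, real_inner_smul_left, real_inner_smul_right, h01,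
      real_inner_comm (pd x 1 p) (pd x 2 p)] at hdiff
    have h12 : ⟪pd x 1 p, pd x 2 p⟫ = 0 :=
      (mul_eq_zero.1 (by linarith : a 2 0 p * ⟪pd x 1 p, pd x 2 p⟫ = 0)).resolve_left h20
    have h02 : ⟪pd x 0 p, pd x 2 p⟫ = 0 :=
      (mul_eq_zero.1 (by linarith : a 2 1 p * ⟪pd x 0 p, pd x 2 p⟫ = 0)).resolve_left h21
    intro i j hij
    fin_cases i <;> fin_cases j <;>
      first
      | exact absurd rfl hij
      | assumption
      | (rw [real_inner_comm]; assumption)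
  · intro h p hp
    refine ⟨h p hp 0 1 (by decide), ?_⟩
    rw [hinner p hp, h p hp 1 2 (by decide), h p hp 0 2 (by decide)]
    ring
end

section
/- Let U ⊆ ℝ³ be an open set, x : ℝ³ → ℝ³ a map that is C² on U, and a_{12}, a_{21}, a_{31}, a_{32} : ℝ³ → ℝ functions with a_{31} differentiable and nonvanishing on U, such that on U: ∂_1∂_2 x = a_{12} ∂_1 x + a_{21} ∂_2 x and ∂_2 a_{31} = a_{31} a_{12} + a_{21} a_{32} − a_{31} a_{32}. Define L_{13} := x − (1/a_{31}) ∂_1 x on U. Then everywhere on U: ∂_2 L_{13} = ((a_{21} − a_{31})/a_{31}) · ( (a_{32}/a_{31}) ∂_1 x − ∂_2 x ). -/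
open RealInnerProductSpace

/-- The iterated partial derivative as a value of the second derivative. -/
theorem ContDiffAt.pd_pd
    {x : EuclideanSpace ℝ (Fin 3) → EuclideanSpace ℝ (Fin 3)} {p : EuclideanSpace ℝ (Fin 3)}
    (hx : ContDiffAt ℝ 2 x p) (i j : Fin 3) :
    pd (pd x i) j p =
      fderiv ℝ (fderiv ℝ x) p (EuclideanSpace.single j 1) (EuclideanSpace.single i 1) := by
  have hd : DifferentiableAt ℝ (fderiv ℝ x) p :=
    (hx.fderiv_right (m := 1) (by norm_num)).differentiableAt one_ne_zero
  have h := hd.hasFDerivAt.clm_apply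
    (hasFDerivAt_const (EuclideanSpace.single i (1 : ℝ) : EuclideanSpace ℝ (Fin 3)) p)
  change fderiv ℝ (fun q => fderiv ℝ x q (EuclideanSpace.single i 1)) p _ = _
  rw [h.fderiv]
  simp

/-- Partial derivatives of a `C²` map commute. -/
theorem ContDiffAt.pd_comm
    {x : EuclideanSpace ℝ (Fin 3) → EuclideanSpace ℝ (Fin 3)} {p : EuclideanSpace ℝ (Fin 3)}
    (hx : ContDiffAt ℝ 2 x p) (i j : Fin 3) : pd (pd x i) j p = pd (pd x j) i p := by
  rw [hx.pd_pd, hx.pd_pd]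
  exact hx.isSymmSndFDerivAt (by simp) _ _

/-- The derivative of `x - a⁻¹ • y` in a coordinate direction. -/
theorem pd_sub_inv_smul
    {x y : EuclideanSpace ℝ (Fin 3) → EuclideanSpace ℝ (Fin 3)}
    {a : EuclideanSpace ℝ (Fin 3) → ℝ} {p : EuclideanSpace ℝ (Fin 3)}
    (hx : DifferentiableAt ℝ x p) (hy : DifferentiableAt ℝ y p)
    (ha : DifferentiableAt ℝ a p) (ha0 : a p ≠ 0) (i : Fin 3) :
    pd (fun q => x q - (a q)⁻¹ • y q) i p =
      pd x i p - ((a p)⁻¹ • pd y i p - (pds a i p / a p ^ 2) • y p) := by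
  have hinv := (hasDerivAt_inv ha0).comp_hasFDerivAt p ha.hasFDerivAt
  have h := hx.hasFDerivAt.fun_sub (hinv.smul hy.hasFDerivAt)
  have h' : fderiv ℝ (fun q => x q - (a q)⁻¹ • y q) p = _ := h.fderiv
  simp only [pd, pds, h']
  simp [div_eq_mul_inv, mul_comm, sub_eq_add_neg]

/-- For a map `x` which is `C²` on an open set `U`, with `a₃₁`
differentiable and nonvanishing on `U`, satisfying `∂₁∂₂x = a₁₂ ∂₁x + a₂₁ ∂₂x` and the
compatibility condition `∂₂a₃₁ = a₃₁a₁₂ + a₂₁a₃₂ − a₃₁a₃₂` on `U`, the Laplace transform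
`L₁₃ = x − (1/a₃₁) ∂₁x` satisfies
`∂₂L₁₃ = ((a₂₁ − a₃₁)/a₃₁) · ((a₃₂/a₃₁) ∂₁x − ∂₂x)` on `U`.
(Indices `1, 2, 3` correspond to `0, 1, 2 : Fin 3`.) -/
theorem derivative_of_laplace_transform
    (U : Set (EuclideanSpace ℝ (Fin 3))) (hU : IsOpen U)
    (x : EuclideanSpace ℝ (Fin 3) → EuclideanSpace ℝ (Fin 3))
    (hx : ContDiffOn ℝ 2 x U)
    (a12 a21 a31 a32 : EuclideanSpace ℝ (Fin 3) → ℝ)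
    (ha31d : DifferentiableOn ℝ a31 U) (ha31 : ∀ p ∈ U, a31 p ≠ 0)
    (h12 : ∀ p ∈ U, pd (pd x 1) 0 p = a12 p • pd x 0 p + a21 p • pd x 1 p)
    (hcomp : ∀ p ∈ U,
      pds a31 1 p = a31 p * a12 p + a21 p * a32 p - a31 p * a32 p) :
    ∀ p ∈ U, pd (fun q => x q - (a31 q)⁻¹ • pd x 0 q) 1 p =
      ((a21 p - a31 p) / a31 p) • ((a32 p / a31 p) • pd x 0 p - pd x 1 p) := by
  intro p hp
  have hxp : ContDiffAt ℝ 2 x p := hx.contDiffAt (hU.mem_nhds hp)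
  have ha := ha31 p hp
  rw [pd_sub_inv_smul (hxp.differentiableAt two_ne_zero) (hxp.differentiableAt_pd 0)
    (ha31d.differentiableAt (hU.mem_nhds hp)) ha, hxp.pd_comm 0 1, h12 p hp, hcomp p hp]
  match_scalars <;> field_simp <;> ring
end

section
/- Let n ≥ 3 and let x_I ∈ ℝ^{n+1}∖{0} be given for each of the seven proper subsets I ⊊ {1,2,3}, viewed as the seven vertices of a combinatorial 3-cube other than the top vertex {1,2,3}. Assume: x_∅, x_{1}, x_{2}, x_{3} are linearly independent; for each 1 ≤ i < j ≤ 3, x_{ij} ∈ span{x_∅, x_i, x_j} and any three of the four vectors x_∅, x_i, x_j, x_{ij} are linearly independent (the three bottom faces are coplanar and nondegenerate); and for each i ∈ {1,2,3} with {j,k} = {1,2,3}∖{i}, the three vectors x_i, x_{ij}, x_{ik} are linearly independent. Then the intersection T := span{x_1, x_{12}, x_{13}} ∩ span{x_2, x_{12}, x_{23}} ∩ span{x_3, x_{13}, x_{23}} has dimension at least 1, and every nonzero x_{123} ∈ T completes the cube to a conjugate configuration: for every face of the cube the linear span of the vectors at its four corners has dimension at most 3. Moreover, if dim T = 1, then this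 completion is unique up to nonzero scalar multiples. -/
/-- The completion of the seven vertex vectors of a cube by a candidate top vector `y`. -/
def cubeExt {n : ℕ} (x : Finset (Fin 3) → (Fin (n + 1) → ℝ)) (y : Fin (n + 1) → ℝ) :
    Finset (Fin 3) → (Fin (n + 1) → ℝ) :=
  fun I => if I = Finset.univ then y else x I

/-- The corners of the face `(k, b)` of the combinatorial 3-cube: the vertices
`I ⊆ {1,2,3}` with `(k ∈ I) = b`.  `b = false` gives the bottom face `f^{ij}` and not
containing `k`, `b = true` the top face `f^{ij}_k`. -/
def cubeFaceCorners (k : Fin 3) (b : Bool) : Set (Finset (Fin 3)) :=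
  {I : Finset (Fin 3) | k ∈ I ↔ b = true}

/-- `y` completes the configuration: for every face of the cube, the span of the vectors
at its four corners has dimension at most 3 (all faces are coplanar in `ℝP^n`). -/
def Completes {n : ℕ} (x : Finset (Fin 3) → (Fin (n + 1) → ℝ))
    (y : Fin (n + 1) → ℝ) : Prop :=
  ∀ (k : Fin 3) (b : Bool),
    Module.finrank ℝ
      (Submodule.span ℝ (cubeExt x y '' cubeFaceCorners k b)) ≤ 3

/-- The intersection of the spans of the three known corner vectors of the three top
faces of the cube. -/
def topInter {n : ℕ} (x : Finset (Fin 3) → (Fin (n + 1) → ℝ)) :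
    Submodule ℝ (Fin (n + 1) → ℝ) :=
  Submodule.span ℝ ({x {0}, x {0, 1}, x {0, 2}} : Set (Fin (n + 1) → ℝ)) ⊓
  Submodule.span ℝ ({x {1}, x {0, 1}, x {1, 2}} : Set (Fin (n + 1) → ℝ)) ⊓
  Submodule.span ℝ ({x {2}, x {0, 2}, x {1, 2}} : Set (Fin (n + 1) → ℝ))

section Coplanarity

variable {K V : Type*} [Field K] [AddCommGroup V] [Module K V]

theorem finrank_span_triple_le (a b c : V) :
    Module.finrank K (Submodule.span K ({a, b, c} : Set V)) ≤ 3 := by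
  classical
  have h := finrank_span_finset_le_card (R := K) ({a, b, c} : Finset V)
  have hcard : ({a, b, c} : Finset V).card ≤ 3 := Finset.card_le_three
  simp only [Finset.coe_insert, Finset.coe_singleton] at h
  exact h.trans hcard

theorem finrank_span_triple_eq {a b c : V} (h : LinearIndependent K ![a, b, c]) :
    Module.finrank K (Submodule.span K ({a, b, c} : Set V)) = 3 := by
  have hrange : Set.range ![a, b, c] = {a, b, c} := by
    simp only [Matrix.range_cons, Matrix.range_empty, Set.union_empty, Set.singleton_union]
  rw [← hrange, finrank_span_eq_card h, Fintype.card_fin]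

theorem span_insert_triple {a b c d : V} (h : d ∈ Submodule.span K ({a, b, c} : Set V)) :
    Submodule.span K ({a, b, c, d} : Set V) = Submodule.span K ({a, b, c} : Set V) := by
  have hset : ({a, b, c, d} : Set V) = insert d {a, b, c} := by
    ext v; simp only [Set.mem_insert_iff, Set.mem_singleton_iff]; tauto
  rw [hset, Submodule.span_insert_eq_span h]

theorem finrank_span_quadruple_le {a b c d : V}
    (h : d ∈ Submodule.span K ({a, b, c} : Set V)) :
    Module.finrank K (Submodule.span K ({a, b, c, d} : Set V)) ≤ 3 := by
  rw [span_insert_triple h]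
  exact finrank_span_triple_le a b c

theorem mem_span_triple_of_finrank_le {a b c d : V} (h : LinearIndependent K ![a, b, c])
    (hd : Module.finrank K (Submodule.span K ({a, b, c, d} : Set V)) ≤ 3) :
    d ∈ Submodule.span K ({a, b, c} : Set V) := by
  have : FiniteDimensional K (Submodule.span K ({a, b, c, d} : Set V)) :=
    FiniteDimensional.span_of_finite K (Set.toFinite _)
  have hle : Submodule.span K ({a, b, c} : Set V) ≤ Submodule.span K {a, b, c, d} := by
    apply Submodule.span_mono
    intro v
    simp only [Set.mem_insert_iff, Set.mem_singleton_iff]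
    tauto
  rw [Submodule.eq_of_le_of_finrank_le hle (hd.trans (finrank_span_triple_eq h).ge)]
  exact Submodule.subset_span (by simp)

theorem finrank_add_finrank_le_of_le [FiniteDimensional K V] {A B W : Submodule K V}
    (hA : A ≤ W) (hB : B ≤ W) :
    Module.finrank K A + Module.finrank K B ≤
      Module.finrank K W + Module.finrank K (A ⊓ B : Submodule K V) := by
  rw [← Submodule.finrank_sup_add_finrank_inf_eq A B]
  gcongr
  exact Submodule.finrank_mono (sup_le hA hB)

end Coplanarity

section Cube

variable {n : ℕ} (x : Finset (Fin 3) → (Fin (n + 1) → ℝ)) (y : Fin (n + 1) → ℝ)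

theorem image_cubeFaceCorners_false {i j k : Fin 3} (hij : i ≠ j) (hik : i ≠ k) (hjk : j ≠ k) :
    cubeExt x y '' cubeFaceCorners k false = {x ∅, x {i}, x {j}, x {i, j}} := by
  have hset : cubeFaceCorners k false = {∅, {i}, {j}, {i, j}} := by
    ext I
    simp only [cubeFaceCorners, Set.mem_ofPred_eq, Set.mem_insert_iff, Set.mem_singleton_iff]
    revert i j k I
    decide
  have h : ∀ I : Finset (Fin 3), k ∉ I → cubeExt x y I = x I := fun I hI =>
    if_neg fun hu : I = Finset.univ => hI (hu ▸ Finset.mem_univ k)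
  rw [hset]
  simp only [Set.image_insert_eq, Set.image_singleton]
  rw [h ∅ (by simp), h {i} (by simp [hik.symm]), h {j} (by simp [hjk.symm]),
    h {i, j} (by simp [hik.symm, hjk.symm])]

theorem image_cubeFaceCorners_true {i j k : Fin 3} (hij : i ≠ j) (hik : i ≠ k) (hjk : j ≠ k) :
    cubeExt x y '' cubeFaceCorners i true = {x {i}, x {i, j}, x {i, k}, y} := by
  have hset : cubeFaceCorners i true = {{i}, {i, j}, {i, k}, Finset.univ} := by
    ext I
    simp only [cubeFaceCorners, Set.mem_ofPred_eq, Set.mem_insert_iff, Set.mem_singleton_iff]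
    revert i j k I
    decide
  have h : ∀ l : Fin 3, ∀ I : Finset (Fin 3), l ∉ I → cubeExt x y I = x I := fun l I hI =>
    if_neg fun hu : I = Finset.univ => hI (hu ▸ Finset.mem_univ l)
  rw [hset]
  simp only [Set.image_insert_eq, Set.image_singleton]
  rw [h j {i} (by simp [hij.symm]), h k {i, j} (by simp [hik.symm, hjk.symm]),
    h j {i, k} (by simp [hij.symm, hjk]), cubeExt, if_pos rfl]

theorem mem_topInter_iff :
    y ∈ topInter x ↔ ∀ i j k : Fin 3, i ≠ j → i ≠ k → j ≠ k →
      y ∈ Submodule.span ℝ ({x {i}, x {i, j}, x {i, k}} : Set (Fin (n + 1) → ℝ)) := by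
  have h10 : ({1, 0} : Finset (Fin 3)) = {0, 1} := by decide
  have h20 : ({2, 0} : Finset (Fin 3)) = {0, 2} := by decide
  have h21 : ({2, 1} : Finset (Fin 3)) = {1, 2} := by decide
  simp only [topInter, Submodule.mem_inf]
  constructor
  · rintro ⟨⟨h0, h1⟩, h2⟩ i j k hij hik hjk
    fin_cases i <;> fin_cases j <;> fin_cases k <;>
      simp_all [Set.pair_comm]
  · intro h
    have h0 := h 0 1 2 (by decide) (by decide) (by decide)
    have h1 := h 1 0 2 (by decide) (by decide) (by decide)
    have h2 := h 2 0 1 (by decide) (by decide) (by decide)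
    rw [h10] at h1
    rw [h20, h21] at h2
    exact ⟨⟨h0, h1⟩, h2⟩

variable {x y}

theorem completes_iff_mem_topInter
    (hbottom : ∀ i j : Fin 3, i ≠ j →
      x {i, j} ∈ Submodule.span ℝ ({x ∅, x {i}, x {j}} : Set (Fin (n + 1) → ℝ)))
    (htop : ∀ i j k : Fin 3, i ≠ j → i ≠ k → j ≠ k →
      LinearIndependent ℝ ![x {i}, x {i, j}, x {i, k}]) :
    Completes x y ↔ y ∈ topInter x := by
  rw [mem_topInter_iff]
  constructor
  · intro h i j k hij hik hjk
    have hi := h i true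
    rw [image_cubeFaceCorners_true x y hij hik hjk] at hi
    exact mem_span_triple_of_finrank_le (htop i j k hij hik hjk) hi
  · intro h k b
    obtain ⟨i, j, hij, hki, hkj⟩ : ∃ i j : Fin 3, i ≠ j ∧ k ≠ i ∧ k ≠ j := by
      revert k; decide
    cases b
    · rw [image_cubeFaceCorners_false x y hij hki.symm hkj.symm]
      exact finrank_span_quadruple_le (hbottom i j hij)
    · rw [image_cubeFaceCorners_true x y hki hkj hij]
      exact finrank_span_quadruple_le (h k i j hki hkj hij)

theorem one_le_finrank_topInter
    (hbottom : ∀ i j : Fin 3, i ≠ j →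
      x {i, j} ∈ Submodule.span ℝ ({x ∅, x {i}, x {j}} : Set (Fin (n + 1) → ℝ)))
    (htop : ∀ i j k : Fin 3, i ≠ j → i ≠ k → j ≠ k →
      LinearIndependent ℝ ![x {i}, x {i, j}, x {i, k}]) :
    1 ≤ Module.finrank ℝ (topInter x) := by
  classical
  set W := Submodule.span ℝ ({x ∅, x {0}, x {1}, x {2}} : Set (Fin (n + 1) → ℝ))
  have hW4 : Module.finrank ℝ W ≤ 4 := by
    have h := finrank_span_finset_le_card (R := ℝ)
      ({x ∅, x {0}, x {1}, x {2}} : Finset (Fin (n + 1) → ℝ))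
    simp only [Finset.coe_insert, Finset.coe_singleton] at h
    exact h.trans Finset.card_le_four
  have hempty : x ∅ ∈ W := Submodule.subset_span (by simp)
  have hsingle : ∀ i : Fin 3, x {i} ∈ W := by
    intro i
    apply Submodule.subset_span
    fin_cases i <;> simp
  have hpair : ∀ i j : Fin 3, i ≠ j → x {i, j} ∈ W := by
    intro i j hij
    refine Submodule.span_le.2 ?_ (hbottom i j hij)
    simp only [Set.insert_subset_iff, Set.singleton_subset_iff, SetLike.mem_coe]
    exact ⟨hempty, hsingle i, hsingle j⟩
  have hface : ∀ i j k : Fin 3, i ≠ j → i ≠ k → j ≠ k →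
      Submodule.span ℝ ({x {i}, x {i, j}, x {i, k}} : Set (Fin (n + 1) → ℝ)) ≤ W ∧
      Module.finrank ℝ (Submodule.span ℝ
        ({x {i}, x {i, j}, x {i, k}} : Set (Fin (n + 1) → ℝ))) = 3 := by
    intro i j k hij hik hjk
    refine ⟨Submodule.span_le.2 ?_, finrank_span_triple_eq (htop i j k hij hik hjk)⟩
    simp only [Set.insert_subset_iff, Set.singleton_subset_iff, SetLike.mem_coe]
    exact ⟨hsingle i, hpair i j hij, hpair i k hik⟩
  obtain ⟨l0, d0⟩ := hface 0 1 2 (by decide) (by decide) (by decide)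
  obtain ⟨l1, d1⟩ := hface 1 0 2 (by decide) (by decide) (by decide)
  obtain ⟨l2, d2⟩ := hface 2 0 1 (by decide) (by decide) (by decide)
  rw [show ({1, 0} : Finset (Fin 3)) = {0, 1} by decide] at l1 d1
  rw [show ({2, 0} : Finset (Fin 3)) = {0, 2} by decide,
    show ({2, 1} : Finset (Fin 3)) = {1, 2} by decide] at l2 d2
  have h01 := finrank_add_finrank_le_of_le l0 l1
  have h012 := finrank_add_finrank_le_of_le (inf_le_of_left_le l0 (b := Submodule.span ℝ
    ({x {1}, x {0, 1}, x {1, 2}} : Set (Fin (n + 1) → ℝ)))) l2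
  rw [topInter]
  omega

end Cube

/-- Seven points of a combinatorial cube in `ℝP^n` (in homogeneous
coordinates) with planar nondegenerate bottom faces determine an eighth point making all
six faces planar: the intersection `T` of the spans of the three top faces is at least
1-dimensional, every nonzero vector of `T` completes the cube to a conjugate
configuration, and if `dim T = 1` the completion is unique up to nonzero scalars. -/
theorem cube_completion_for_conjugate_nets {n : ℕ} (hn : 3 ≤ n)
    (x : Finset (Fin 3) → (Fin (n + 1) → ℝ))
    (hne : ∀ I : Finset (Fin 3), I ≠ Finset.univ → x I ≠ 0)
    -- the bottom vertex and its three neighbours are in general position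
    (hindep4 : LinearIndependent ℝ ![x ∅, x {0}, x {1}, x {2}])
    -- the three bottom faces are coplanar and nondegenerate
    (hbottom : ∀ i j : Fin 3, i ≠ j →
      x {i, j} ∈ Submodule.span ℝ ({x ∅, x {i}, x {j}} : Set (Fin (n + 1) → ℝ)) ∧
      LinearIndependent ℝ ![x ∅, x {i}, x {j}] ∧
      LinearIndependent ℝ ![x ∅, x {i}, x {i, j}] ∧
      LinearIndependent ℝ ![x ∅, x {j}, x {i, j}] ∧
      LinearIndependent ℝ ![x {i}, x {j}, x {i, j}])
    -- the three known corner vectors of each top face are linearly independent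
    (htop : ∀ i j k : Fin 3, i ≠ j → i ≠ k → j ≠ k →
      LinearIndependent ℝ ![x {i}, x {i, j}, x {i, k}]) :
    1 ≤ Module.finrank ℝ (topInter x) ∧
    (∀ y ∈ topInter x, y ≠ 0 → Completes x y) ∧
    (Module.finrank ℝ (topInter x) = 1 →
      ∀ z₁ z₂ : Fin (n + 1) → ℝ, z₁ ≠ 0 → z₂ ≠ 0 →
        Completes x z₁ → Completes x z₂ →
        ∃ c : ℝ, c ≠ 0 ∧ z₂ = c • z₁) := by
  have hplanar := fun i j hij => (hbottom i j hij).1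
  refine ⟨one_le_finrank_topInter hplanar htop,
    fun y hy _ => (completes_iff_mem_topInter hplanar htop).2 hy, ?_⟩
  intro hdim z₁ z₂ hz₁ hz₂ hc₁ hc₂
  rw [completes_iff_mem_topInter hplanar htop] at hc₁ hc₂
  obtain ⟨c, hc⟩ := exists_smul_eq_of_finrank_eq_one hdim
    (x := (⟨z₁, hc₁⟩ : topInter x)) (by simpa [Subtype.ext_iff] using hz₁) ⟨z₂, hc₂⟩
  have hz : c • z₁ = z₂ := congrArg Subtype.val hc
  refine ⟨c, ?_, hz.symm⟩
  rintro rfl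
  exact hz₂ (by rw [← hz, zero_smul])
end
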